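/- arXiv:math/0005139 — 3 statements merged into one kernel-verified Lean document; each statement's English description precedes it below -/
import Mathlib

section
/- For each positive integer n there exists a function M_n : (0,∞) → (0,∞) with the following property: for every full-rank lattice Λ ⊂ ℝⁿ (a discrete subgroup of ℝⁿ spanning ℝⁿ) with covolume |Λ| = Vol(ℝⁿ/Λ), and for every r > 0 such that the dual lattice Λ* contains no nonzero vector of Euclidean length < r, and for every R > 0, the number of vectors of Λ of Euclidean length ≤ R is at most M_n(rR) · r^{−n} · |Λ|^{−1}. -/
open MeasureTheory
open scoped Pointwise
noncomputable local instance latticeAuxMS : MeasureSpace UnitAddCircle := ⟨AddCircle.haarAddCircle⟩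
local instance latticeAuxHaar : Measure.IsAddHaarMeasure (volume : Measure UnitAddCircle) :=
  inferInstanceAs (Measure.IsAddHaarMeasure AddCircle.haarAddCircle)
local instance latticeAuxProb : IsProbabilityMeasure (volume : Measure UnitAddCircle) :=
  inferInstanceAs (IsProbabilityMeasure AddCircle.haarAddCircle)

open UnitAddTorus

/-- Markov inequality for an exponential sum on the torus. -/
lemma torus_markov {n : ℕ} (S : Finset (Fin n → ℤ)) :
    ENNReal.ofReal ((S.card : ℝ) / 2) ^ 2 *
      (volume : Measure (UnitAddTorus (Fin n))) {z | (S.card : ℝ) / 2 ≤ ‖∑ m ∈ S, mFourier m z‖}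
      ≤ (S.card : ENNReal) := by
  set f : C(UnitAddTorus (Fin n), ℂ) := ∑ m ∈ S, mFourier m with hf
  have h1 : ContinuousMap.toLp (E := ℂ) 2 volume ℂ f = ∑ m ∈ S, mFourierLp 2 m := by
    rw [hf, map_sum]
  have h2 : ‖ContinuousMap.toLp (E := ℂ) 2 volume ℂ f‖ ^ 2 = (S.card : ℝ) := by
    have := (orthonormal_mFourier (d := Fin n)).inner_sum (fun _ => (1:ℂ)) (fun _ => 1) S
    simp only [one_smul] at this
    rw [h1, ← inner_self_eq_norm_sq (𝕜 := ℂ), this]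
    simp
  have h3 : eLpNorm f 2 (volume : Measure (UnitAddTorus (Fin n))) ^ 2 = (S.card : ENNReal) := by
    rw [← eLpNorm_congr_ae (ContinuousMap.coeFn_toLp (p := 2) (𝕜 := ℂ) volume f),
      ← Lp.enorm_def, ← ofReal_norm, ← ENNReal.ofReal_pow (norm_nonneg _), h2]
    simp
  have h4 := mul_meas_ge_le_pow_eLpNorm' (volume : Measure (UnitAddTorus (Fin n)))
    (p := 2) (by simp) (by simp) (f := f) f.continuous.aestronglyMeasurable
    (ENNReal.ofReal ((S.card : ℝ) / 2))
  simp only [ENNReal.toReal_ofNat, ENNReal.rpow_ofNat] at h4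
  rw [h3] at h4
  refine le_trans (le_of_eq ?_) h4
  congr 2
  ext z
  simp only [Set.mem_ofPred_eq, ← ofReal_norm, hf, ContinuousMap.sum_apply]
  rw [ENNReal.ofReal_le_ofReal_iff (norm_nonneg _)]

lemma volume_le_torus {n : ℕ} (K : Set (Fin n → ℝ)) (hK : MeasurableSet K)
    (hinj : ∀ u ∈ K, ∀ v ∈ K, (∀ i, ∃ m : ℤ, u i - v i = m) → u = v)
    (A : Set (UnitAddTorus (Fin n))) (hA : MeasurableSet A)
    (hKA : ∀ u ∈ K, (fun i => (u i : UnitAddCircle)) ∈ A) :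
    volume K ≤ volume A := by
  set F : Set (Fin n → ℝ) := {x | ∀ i, x i ∈ Set.Ioc (0:ℝ) (0 + 1)} with hF
  have hFm : MeasurableSet F := MeasurableSet.univ_pi' (fun i => measurableSet_Ioc)
  have hpm : Measurable (fun (u : Fin n → ℝ) (i : Fin n) => (u i : UnitAddCircle)) :=
    measurable_pi_lambda _ (fun i => AddCircle.measurable_mk'.comp (measurable_pi_apply i))
  set B : Set (Fin n → ℝ) := (fun (u : Fin n → ℝ) (i : Fin n) => (u i : UnitAddCircle)) ⁻¹' A with hB
  have hBm : MeasurableSet B := hpm hA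
  have h1 : volume A = volume (B ∩ F) := by
    have := lintegral_preimage (A.indicator (1 : UnitAddTorus (Fin n) → ENNReal)) (fun _ : Fin n => (0:ℝ))
    rw [lintegral_indicator_one hA] at this
    rw [this]
    have h : ∀ x : Fin n → ℝ, A.indicator (1 : UnitAddTorus (Fin n) → ENNReal) (fun i => (x i : UnitAddCircle))
      = B.indicator 1 x := fun x => rfl
    simp_rw [h]
    rw [lintegral_indicator_one hBm, Measure.restrict_apply hBm]
  let L := Submodule.span ℤ (Set.range (Pi.basisFun ℝ (Fin n)))
  let G := ZSpan.fundamentalDomain (Pi.basisFun ℝ (Fin n))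
  have hfd : IsAddFundamentalDomain L G volume := ZSpan.isAddFundamentalDomain _ _
  have hLint : ∀ g : L, ∀ i, ∃ m : ℤ, (g : Fin n → ℝ) i = m := by
    intro g i
    have := ((Pi.basisFun ℝ (Fin n)).mem_span_iff_repr_mem ℤ (g : Fin n → ℝ)).1 g.2 i
    obtain ⟨m, hm⟩ := this
    exact ⟨m, by simpa using hm.symm⟩
  have hGF : G =ᵐ[volume] F := by
    have e1 : G = Set.pi Set.univ fun _ : Fin n => Set.Ico (0:ℝ) 1 :=
      ZSpan.fundamentalDomain_pi_basisFun
    have e2 : F = Set.pi Set.univ fun _ : Fin n => Set.Ioc (0:ℝ) 1 := by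
      ext x; simp [F]
    rw [e1, e2]
    exact (Measure.univ_pi_Ico_ae_eq_Icc (f := fun _ => (0:ℝ)) (g := fun _ => 1)).trans
      (Measure.univ_pi_Ioc_ae_eq_Icc (f := fun _ => (0:ℝ)) (g := fun _ => 1)).symm
  have hGm : MeasurableSet G := ZSpan.fundamentalDomain_measurableSet _
  have : VAddInvariantMeasure L (Fin n → ℝ) volume :=
    inferInstanceAs <| VAddInvariantMeasure L.toAddSubgroup (Fin n → ℝ) volume
  have : Countable L := inferInstanceAs <| Countable (Submodule.span ℤ (Set.range (Pi.basisFun ℝ (Fin n))))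
  have hvm : ∀ g : L, MeasurableSet (g +ᵥ K) := by
    intro g
    have : (g +ᵥ K) = (fun x => x - (g : Fin n → ℝ)) ⁻¹' K := by
      ext x
      simp only [Set.mem_vadd_set, Set.mem_preimage]
      constructor
      · rintro ⟨y, hy, rfl⟩
        simpa [Submodule.vadd_def] using hy
      · intro hx
        exact ⟨_, hx, by simp [Submodule.vadd_def]⟩
    rw [this]
    exact (measurable_id.sub_const _) hK
  rw [h1, ← measure_congr (Filter.EventuallyEq.inter (ae_eq_refl B) hGF), hfd.measure_eq_tsum K,
    ← measure_iUnion ?_ (fun g => (hvm g).inter hGm)]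
  · apply measure_mono
    rintro x hx
    obtain ⟨g, ⟨y, hy, rfl⟩, hx2⟩ := Set.mem_iUnion.1 hx
    refine ⟨?_, hx2⟩
    have := hKA y hy
    simp only [hB, Set.mem_preimage]
    convert this using 2 with i
    obtain ⟨m, hm⟩ := hLint g i
    simp only [vadd_eq_add, Pi.add_apply, hm]
    rw [AddCircle.coe_add]
    simp
  · intro g g' hgg
    rw [Function.onFun, Set.disjoint_left]
    rintro x ⟨⟨y, hy, rfl⟩, -⟩ ⟨⟨y', hy', h⟩, -⟩
    simp only [vadd_eq_add] at h
    apply hgg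
    have : y = y' := by
      apply hinj y hy y' hy'
      intro i
      obtain ⟨m, hm⟩ := hLint g i
      obtain ⟨m', hm'⟩ := hLint g' i
      refine ⟨m' - m, ?_⟩
      have := congrFun h i
      simp only [Pi.add_apply, hm, hm'] at this
      push_cast
      linarith
    subst this
    exact (Subtype.ext (add_right_cancel h)).symm

lemma core_bound {n : ℕ} (K : Set (Fin n → ℝ)) (hK : MeasurableSet K)
    (hinj : ∀ u ∈ K, ∀ v ∈ K, (∀ i, ∃ m : ℤ, u i - v i = m) → u = v)
    (S : Finset (Fin n → ℤ))
    (hS : ∀ u ∈ K, ∀ m ∈ S, (1 : ℝ) / 2 ≤ Real.cos (2 * Real.pi * ∑ i, m i * u i)) :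
    ENNReal.ofReal ((S.card : ℝ) / 2) ^ 2 * volume K ≤ (S.card : ENNReal) := by
  refine le_trans ?_ (torus_markov S)
  gcongr
  apply volume_le_torus K hK hinj
  · apply measurableSet_le measurable_const
    apply Continuous.measurable
    fun_prop
  · intro u hu
    have e : ∀ m : Fin n → ℤ, mFourier m (fun i => (u i : UnitAddCircle)) =
        Complex.exp ((2 * Real.pi * ∑ i, m i * u i : ℝ) * Complex.I) := by
      intro m
      simp only [mFourier, ContinuousMap.coe_mk, fourier_coe_apply]
      rw [← Complex.exp_sum]
      congr 1
      push_cast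
      rw [Finset.mul_sum, Finset.sum_mul]
      refine Finset.sum_congr rfl fun i _ => ?_
      ring
    refine le_trans ?_ (Complex.re_le_norm _)
    rw [Complex.re_sum]
    simp_rw [e, Complex.exp_ofReal_mul_I_re]
    calc (S.card : ℝ) / 2 = ∑ m ∈ S, (1:ℝ)/2 := by simp; ring
      _ ≤ _ := Finset.sum_le_sum (fun m hm => hS u hu m hm)

theorem lattice_point_count_bound (n : ℕ) (hn : 0 < n) :
    ∃ M : ℝ → ℝ, (∀ t : ℝ, 0 < t → 0 < M t) ∧
      ∀ (L : Submodule ℤ (EuclideanSpace ℝ (Fin n))) [DiscreteTopology L] [IsZLattice ℝ L]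
        (r R : ℝ), 0 < r → 0 < R →
        (∀ y : EuclideanSpace ℝ (Fin n),
            (∀ x ∈ L, ∃ m : ℤ, (inner ℝ x y : ℝ) = (m : ℝ)) → y ≠ 0 → r ≤ ‖y‖) →
        (Nat.card {x : EuclideanSpace ℝ (Fin n) // x ∈ L ∧ ‖x‖ ≤ R} : ℝ) ≤
          M (r * R) * r ^ (-(n : ℤ)) * (ZLattice.covolume L)⁻¹ := by
  set ω : ℝ := (volume : Measure (EuclideanSpace ℝ (Fin n))).real (Metric.ball 0 1) with hω
  have hω0 : 0 < ω := by
    rw [hω, measureReal_def]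
    exact ENNReal.toReal_pos (Metric.measure_ball_pos _ _ one_pos).ne' measure_ball_lt_top.ne
  refine ⟨fun t => 4 / ((min (1 / 2) (1 / (8 * t))) ^ n * ω), fun t ht => by positivity, ?_⟩
  intro L _ _ r R hr hR hdual
  have hcov : 0 < ZLattice.covolume L := ZLattice.covolume_pos L volume
  set c : ℝ := min (1 / 2) (1 / (8 * (r * R))) with hc
  have hc0 : 0 < c := by positivity
  set ρ : ℝ := r * c with hρ
  have hρ0 : 0 < ρ := by positivity
  have hρr : ρ ≤ r / 2 := by
    have : c ≤ 1 / 2 := min_le_left _ _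
    nlinarith
  have hρR : R * ρ ≤ 1 / 8 := by
    have h : c ≤ 1 / (8 * (r * R)) := min_le_right _ _
    rw [le_div_iff₀ (by positivity)] at h
    nlinarith
  -- trivial if the set is infinite
  rcases finite_or_infinite {x : EuclideanSpace ℝ (Fin n) // x ∈ L ∧ ‖x‖ ≤ R} with hfin | hinf
  swap
  · rw [Nat.card_eq_zero_of_infinite]
    simp only [Nat.cast_zero]
    positivity
  have := ZLattice.module_finite ℝ L
  have := ZLattice.module_free ℝ L
  have hrank : Module.finrank ℤ L = n := by
    rw [ZLattice.rank ℝ L]; simp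
  let b : Module.Basis (Fin n) ℤ L := Module.finBasisOfFinrankEq ℤ L hrank
  let A : Matrix (Fin n) (Fin n) ℝ := Matrix.of fun i j => (b i : EuclideanSpace ℝ (Fin n)) j
  have hdet : ZLattice.covolume L = |A.det| := by
    let e := EuclideanSpace.basisFun (Fin n) ℝ
    rw [ZLattice.covolume_eq_det_mul_measureReal L volume b e.toBasis,
      measureReal_congr (ZSpan.fundamentalDomain_ae_parallelepiped e.toBasis volume),
      measureReal_def, OrthonormalBasis.coe_toBasis, e.volume_parallelepiped,
      ENNReal.toReal_one, mul_one, Module.Basis.det_apply, ← Matrix.det_transpose]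
    congr 2
  have hA0 : A.det ≠ 0 := by
    intro h; rw [h, abs_zero] at hdet; exact hcov.ne' hdet
  have hAinj : Function.Injective (Matrix.toLin' A) := by
    have := Matrix.mulVec_injective_iff_isUnit.2 ((Matrix.isUnit_iff_isUnit_det A).2 hA0.isUnit)
    intro x y h
    exact this (by simpa using h)
  have hAy : ∀ (y : Fin n → ℝ) (i : Fin n),
      Matrix.toLin' A y i = inner ℝ (b i : EuclideanSpace ℝ (Fin n)) (WithLp.toLp 2 y) := by
    intro y i
    simp [Matrix.toLin'_apply, Matrix.mulVec, dotProduct, PiLp.inner_apply, A, mul_comm]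
  have hxrepr : ∀ (x : L) (y : EuclideanSpace ℝ (Fin n)),
      inner ℝ (x : EuclideanSpace ℝ (Fin n)) y =
        ∑ i, ((b.repr x i : ℤ) : ℝ) * inner ℝ (b i : EuclideanSpace ℝ (Fin n)) y := by
    intro x y
    have h : (x : EuclideanSpace ℝ (Fin n)) =
        ∑ i, ((b.repr x i : ℤ) : ℝ) • (b i : EuclideanSpace ℝ (Fin n)) := by
      conv_lhs => rw [← b.sum_repr x]
      rw [AddSubmonoidClass.coe_finsetSum]
      refine Finset.sum_congr rfl fun i _ => ?_
      rw [Int.cast_smul_eq_zsmul]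
      rfl
    conv_lhs => rw [h]
    rw [sum_inner]
    simp [real_inner_smul_left]
  let B : Set (Fin n → ℝ) := WithLp.toLp 2 ⁻¹' Metric.ball (0 : EuclideanSpace ℝ (Fin n)) ρ
  have hBm : MeasurableSet B :=
    (PiLp.volume_preserving_toLp (Fin n)).measurable measurableSet_ball
  have hBv : volume B = ENNReal.ofReal (ρ ^ n * ω) := by
    rw [(PiLp.volume_preserving_toLp (Fin n)).measure_preimage
      measurableSet_ball.nullMeasurableSet, Measure.addHaar_ball_of_pos _ _ hρ0,
      ENNReal.ofReal_mul (by positivity), hω, measureReal_def,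
      ENNReal.ofReal_toReal measure_ball_lt_top.ne]
    simp
  let K : Set (Fin n → ℝ) := Matrix.toLin' A '' B
  have hKm : MeasurableSet K :=
    hBm.image_of_continuousOn_injOn (LinearMap.continuous_of_finiteDimensional _).continuousOn
      hAinj.injOn
  have hKv : volume K = ENNReal.ofReal (ZLattice.covolume L * (ρ ^ n * ω)) := by
    rw [Measure.addHaar_image_linearMap, hBv, LinearMap.det_toLin', ← hdet,
      ENNReal.ofReal_mul hcov.le]
  have := Fintype.ofFinite {x : EuclideanSpace ℝ (Fin n) // x ∈ L ∧ ‖x‖ ≤ R}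
  let j : {x : EuclideanSpace ℝ (Fin n) // x ∈ L ∧ ‖x‖ ≤ R} → (Fin n → ℤ) :=
    fun x => b.repr ⟨x.1, x.2.1⟩
  have hj : Function.Injective j := by
    intro x y h
    have := b.repr.injective (DFunLike.coe_injective h)
    exact Subtype.ext (by simpa using this)
  let S : Finset (Fin n → ℤ) := Finset.univ.map ⟨j, hj⟩
  have hScard : S.card = Nat.card {x : EuclideanSpace ℝ (Fin n) // x ∈ L ∧ ‖x‖ ≤ R} := by
    simp [S, Nat.card_eq_fintype_card]
  have key := core_bound K hKm ?_ S ?_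
  · rw [← hScard]
    clear_value S
    have hS0 : (0 : ℝ) ≤ S.card := Nat.cast_nonneg _
    rw [hKv, ← ENNReal.ofReal_pow (div_nonneg hS0 zero_le_two),
      ← ENNReal.ofReal_mul (sq_nonneg _),
      ← ENNReal.ofReal_natCast, ENNReal.ofReal_le_ofReal_iff hS0] at key
    rcases Nat.eq_zero_or_pos S.card with h0 | h0
    · rw [h0]; simp only [Nat.cast_zero]; positivity
    have h0' : (0 : ℝ) < S.card := by exact_mod_cast h0
    have h5 : (S.card : ℝ) * (ZLattice.covolume L * (ρ ^ n * ω)) ≤ 4 := by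
      refine le_of_mul_le_mul_left ?_ h0'
      nlinarith
    have h6 : 4 / (c ^ n * ω) * r ^ (-(n : ℤ)) * (ZLattice.covolume L)⁻¹ =
        4 / (ZLattice.covolume L * (ρ ^ n * ω)) := by
      rw [hρ, mul_pow, zpow_neg, zpow_natCast]
      field_simp
    show (S.card : ℝ) ≤ 4 / (c ^ n * ω) * r ^ (-(n : ℤ)) * (ZLattice.covolume L)⁻¹
    rw [h6, le_div_iff₀ (by positivity)]
    exact h5
  · rintro _ ⟨y, hy, rfl⟩ _ ⟨y', hy', rfl⟩ h
    congr 1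
    by_contra hne
    choose m hm using h
    have hle := hdual (WithLp.toLp 2 (y - y')) ?_ ?_
    · have h1 : ‖WithLp.toLp 2 y‖ < ρ := mem_ball_zero_iff.1 hy
      have h2 : ‖WithLp.toLp 2 y'‖ < ρ := mem_ball_zero_iff.1 hy'
      have h3 := norm_sub_le (WithLp.toLp 2 y) (WithLp.toLp 2 y')
      rw [← WithLp.toLp_sub] at h3
      linarith
    · intro x hx
      refine ⟨∑ i, b.repr ⟨x, hx⟩ i * m i, ?_⟩
      rw [hxrepr ⟨x, hx⟩]
      push_cast
      refine Finset.sum_congr rfl fun i _ => ?_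
      rw [← hAy, map_sub, Pi.sub_apply, hm]
    · intro h
      apply hne
      have : y - y' = 0 := by simpa only [WithLp.toLp_eq_zero] using h
      exact sub_eq_zero.1 this
  · rintro _ ⟨y, hy, rfl⟩ m hm
    obtain ⟨x, -, rfl⟩ := Finset.mem_map.1 hm
    have h1 : ‖WithLp.toLp 2 y‖ < ρ := mem_ball_zero_iff.1 hy
    have h2 : ∑ i, ((j x i : ℤ) : ℝ) * Matrix.toLin' A y i = inner ℝ x.1 (WithLp.toLp 2 y) := by
      simp_rw [hAy]
      exact (hxrepr ⟨x.1, x.2.1⟩ _).symm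
    show (1 : ℝ) / 2 ≤ Real.cos (2 * Real.pi * ∑ i, ((j x i : ℤ) : ℝ) * Matrix.toLin' A y i)
    rw [h2]
    have h3 : |inner ℝ x.1 (WithLp.toLp 2 y)| ≤ 1 / 8 := by
      refine (abs_real_inner_le_norm _ _).trans (le_trans ?_ hρR)
      exact mul_le_mul x.2.2 h1.le (norm_nonneg _) hR.le
    rw [← Real.cos_abs, ← Real.cos_pi_div_three, abs_mul, abs_of_pos (by positivity)]
    have hpi := Real.pi_pos
    apply Real.cos_le_cos_of_nonneg_of_le_pi
    · positivity
    · linarith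
    · nlinarith
end

section
/- For each positive integer n there exists a constant A_n > 0 such that for every full-rank lattice Λ ⊂ ℝⁿ with covolume |Λ| and every R > 0: if the number of vectors of Λ of Euclidean length < R exceeds A_n · Rⁿ / |Λ|, then all vectors of Λ of Euclidean length < R lie in a single linear hyperplane of ℝⁿ (equivalently, there is a nonzero y ∈ ℝⁿ orthogonal to every vector of Λ of length < R). -/
open scoped Pointwise in
open MeasureTheory Module in
/-- If the lattice vectors of length `< R` contain a basis, their number times the covolume is
bounded by the volume of the ball of radius `(n+1) R`. -/
theorem card_mul_covolume_le (n : ℕ)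
    (L : Submodule ℤ (EuclideanSpace ℝ (Fin n))) [DiscreteTopology L] [IsZLattice ℝ L]
    (R : ℝ) {ι : Type} [Fintype ι] (b : Basis ι ℝ (EuclideanSpace ℝ (Fin n)))
    (hb : ∀ i, b i ∈ L ∧ ‖b i‖ < R)
    [Finite {x : EuclideanSpace ℝ (Fin n) // x ∈ L ∧ ‖x‖ < R}] :
    (Nat.card {x : EuclideanSpace ℝ (Fin n) // x ∈ L ∧ ‖x‖ < R} : ℝ) * ZLattice.covolume L ≤
      volume.real (Metric.ball (0 : EuclideanSpace ℝ (Fin n)) ((n + 1) * R)) := by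
  set S := {x : EuclideanSpace ℝ (Fin n) // x ∈ L ∧ ‖x‖ < R} with hS
  set t := Metric.ball (0 : EuclideanSpace ℝ (Fin n)) ((n + 1) * R) with ht
  have : Fintype S := Fintype.ofFinite _
  have hcard : Fintype.card ι = n := by
    rw [← finrank_eq_card_basis b]; simp
  have : MeasurableVAdd L (EuclideanSpace ℝ (Fin n)) :=
    (inferInstance : MeasurableVAdd L.toAddSubgroup _)
  have : VAddInvariantMeasure L (EuclideanSpace ℝ (Fin n)) volume :=
    (inferInstance : VAddInvariantMeasure L.toAddSubgroup _ volume)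
  let c := Module.Free.chooseBasis ℤ L
  let F := ZSpan.fundamentalDomain (c.ofZLatticeBasis ℝ)
  have fund : IsAddFundamentalDomain L F volume := ZLattice.isAddFundamentalDomain c volume
  have hspan : Submodule.span ℤ (Set.range b) ≤ L := by
    rw [Submodule.span_le]
    rintro _ ⟨i, rfl⟩
    exact (hb i).1
  have hmeas : ∀ g : L, MeasurableSet (g +ᵥ t) := fun g =>
    Metric.isOpen_ball.measurableSet.const_vadd g
  have key : ∀ x : EuclideanSpace ℝ (Fin n),
      (Nat.card S : ENNReal) ≤ ∑' g : L, (g +ᵥ t).indicator (fun _ => (1 : ENNReal)) x := by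
    intro x
    let φ : S → L := fun s => ⟨(ZSpan.floor b x : EuclideanSpace ℝ (Fin n)) - s.1,
      L.sub_mem (hspan (ZSpan.floor b x).2) s.2.1⟩
    have hφ : Function.Injective φ := by
      intro s s' h
      have := congrArg Subtype.val h
      simp only [φ, sub_right_inj] at this
      exact Subtype.ext this
    refine le_trans ?_ (ENNReal.tsum_comp_le_tsum_of_injective hφ _)
    have h1 : ∀ s : S, (φ s +ᵥ t).indicator (fun _ => (1 : ENNReal)) x = 1 := by
      intro s
      apply Set.indicator_of_mem
      refine ⟨ZSpan.fract b x + s.1, ?_, ?_⟩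
      · rw [ht, mem_ball_zero_iff]
        have h2 : ‖ZSpan.fract b x‖ ≤ n * R := by
          refine (ZSpan.norm_fract_le b x).trans ?_
          refine (Finset.sum_le_sum fun i _ => (hb i).2.le).trans ?_
          simp [hcard]
        have := s.2.2
        have := norm_add_le (ZSpan.fract b x) s.1
        linarith
      · change (φ s : EuclideanSpace ℝ (Fin n)) + (ZSpan.fract b x + s.1) = x
        simp only [φ, ZSpan.fract_apply]
        abel
    simp [h1]
  have h3 : (Nat.card S : ENNReal) * volume F ≤ volume t := by
    rw [fund.measure_eq_tsum t]
    calc (Nat.card S : ENNReal) * volume F = ∫⁻ x in F, (Nat.card S : ENNReal) := by simp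
      _ ≤ ∫⁻ x in F, ∑' g : L, (g +ᵥ t).indicator (fun _ => (1 : ENNReal)) x :=
          lintegral_mono fun x => key x
      _ = ∑' g : L, ∫⁻ x in F, (g +ᵥ t).indicator (fun _ => (1 : ENNReal)) x :=
          lintegral_tsum fun g => (measurable_const.indicator (hmeas g)).aemeasurable
      _ = ∑' g : L, volume ((g +ᵥ t) ∩ F) := by
          refine tsum_congr fun g => ?_
          rw [lintegral_indicator (hmeas g)]
          simp [Measure.restrict_apply, Measure.restrict_restrict (hmeas g)]
  rw [ZLattice.covolume_eq_measure_fundamentalDomain L volume fund]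
  have := ENNReal.toReal_mono (measure_ball_lt_top.ne) h3
  simpa [measureReal_def] using this

/-- For each positive integer `n` there is a constant `A_n > 0` such that if a full-rank lattice
`Λ ⊂ ℝⁿ` has more than `A_n * Rⁿ / |Λ|` vectors of length `< R`, then all those vectors lie in a
hyperplane, i.e. there is a nonzero `y` orthogonal to all of them. -/
theorem lattice_many_short_vectors_in_hyperplane (n : ℕ) (hn : 0 < n) :
    ∃ A : ℝ, 0 < A ∧
      ∀ (L : Submodule ℤ (EuclideanSpace ℝ (Fin n))) [DiscreteTopology L] [IsZLattice ℝ L]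
        (R : ℝ), 0 < R →
        A * R ^ n / ZLattice.covolume L <
          (Nat.card {x : EuclideanSpace ℝ (Fin n) // x ∈ L ∧ ‖x‖ < R} : ℝ) →
        ∃ y : EuclideanSpace ℝ (Fin n), y ≠ 0 ∧
          ∀ x ∈ L, ‖x‖ < R → (inner ℝ y x : ℝ) = 0 := by
  refine ⟨MeasureTheory.volume.real (Metric.ball (0 : EuclideanSpace ℝ (Fin n)) (n + 1)),
    ENNReal.toReal_pos (Metric.measure_ball_pos _ _ (by positivity)).ne'
      MeasureTheory.measure_ball_lt_top.ne, ?_⟩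
  intro L _ _ R hR h
  by_contra hcon
  push Not at hcon
  have hcov := ZLattice.covolume_pos L
  have hpos : (0 : ℝ) < (Nat.card {x : EuclideanSpace ℝ (Fin n) // x ∈ L ∧ ‖x‖ < R} : ℝ) :=
    lt_of_le_of_lt (by positivity) h
  have : Finite {x : EuclideanSpace ℝ (Fin n) // x ∈ L ∧ ‖x‖ < R} :=
    Nat.finite_of_card_ne_zero (by exact_mod_cast hpos.ne')
  let s : Set (EuclideanSpace ℝ (Fin n)) := {x | x ∈ L ∧ ‖x‖ < R}
  have hs : ⊤ ≤ Submodule.span ℝ s := by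
    rw [top_le_iff, ← Submodule.orthogonal_eq_bot_iff, Submodule.eq_bot_iff]
    intro y hy
    by_contra hy0
    obtain ⟨x, hx, hxR, hne⟩ := hcon y hy0
    exact hne (Submodule.inner_left_of_mem_orthogonal (Submodule.subset_span (s := s) ⟨hx, hxR⟩) hy)
  let b := Module.Basis.ofSpan hs
  have hb : ∀ i, b i ∈ L ∧ ‖b i‖ < R := fun i =>
    Module.Basis.ofSpan_subset hs (Set.mem_range_self i)
  have := FiniteDimensional.fintypeBasisIndex b
  have h1 := card_mul_covolume_le n L R b hb
  have h2 : MeasureTheory.volume.real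
      (Metric.ball (0 : EuclideanSpace ℝ (Fin n)) ((n + 1) * R)) =
      MeasureTheory.volume.real (Metric.ball (0 : EuclideanSpace ℝ (Fin n)) (n + 1)) * R ^ n := by
    rw [mul_comm ((n : ℝ) + 1) R, MeasureTheory.measureReal_def, MeasureTheory.measureReal_def,
      MeasureTheory.Measure.addHaar_ball_mul_of_pos _ _ hR]
    simp [ENNReal.toReal_mul, hR.le, mul_comm]
  rw [div_lt_iff₀ hcov] at h
  linarith
end

section
/- Let n be a positive integer, let c satisfy 0 < c < 2π/n, and set a = 1/c² − n/(2πc). Define f : ℝⁿ → ℝ by f(x) = (|x|² + a)·e^{−πc|x|²} and let f̂(y) = ∫_{ℝⁿ} f(x) e^{2πi⟨x,y⟩} dx be its Fourier transform. Then f(x) > 0 for every x ∈ ℝⁿ, and f̂(y) ≤ 0 for every y ∈ ℝⁿ with |y| ≥ 1. -/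
open scoped Real

open MeasureTheory in
theorem aux_integral (n : ℕ) (b : ℝ) (hb : 0 < b) (y : EuclideanSpace ℝ (Fin n)) :
    ∫ x : EuclideanSpace ℝ (Fin n),
      Complex.exp (-(b : ℂ) * ‖x‖ ^ 2 + (2 * π * Complex.I) * ((inner ℝ y x : ℝ) : ℂ))
      = (((π / b) ^ ((n : ℝ) / 2) * Real.exp (-π ^ 2 * ‖y‖ ^ 2 / b) : ℝ) : ℂ) := by
  have h := GaussianFourier.integral_cexp_neg_mul_sq_norm_add (V := EuclideanSpace ℝ (Fin n))
    (b := (b : ℂ)) (by simpa using hb) (2 * π * Complex.I) y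
  rw [h]
  have hb0 : (b : ℂ) ≠ 0 := by exact_mod_cast hb.ne'
  push_cast
  rw [Complex.ofReal_cpow (by positivity)]
  push_cast
  congr 1
  · simp
  · congr 1
    field_simp
    rw [Complex.I_sq]
    ring

open MeasureTheory in
theorem aux_main (n : ℕ) (b : ℝ) (hb : 0 < b) (y : EuclideanSpace ℝ (Fin n)) :
    Integrable (fun x : EuclideanSpace ℝ (Fin n) => -(‖x‖ : ℂ) ^ 2 *
      Complex.exp (-(b : ℂ) * ‖x‖ ^ 2 + (2 * π * Complex.I) * ((inner ℝ y x : ℝ) : ℂ))) ∧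
    ∫ x : EuclideanSpace ℝ (Fin n), -(‖x‖ : ℂ) ^ 2 *
      Complex.exp (-(b : ℂ) * ‖x‖ ^ 2 + (2 * π * Complex.I) * ((inner ℝ y x : ℝ) : ℂ))
      = (((π ^ 2 * ‖y‖ ^ 2 / b ^ 2 - n / (2 * b)) *
        ((π / b) ^ ((n : ℝ) / 2) * Real.exp (-π ^ 2 * ‖y‖ ^ 2 / b)) : ℝ) : ℂ) := by
  have key := hasDerivAt_integral_of_dominated_loc_of_deriv_le
    (μ := (volume : Measure (EuclideanSpace ℝ (Fin n))))
    (F := fun (t : ℝ) (x : EuclideanSpace ℝ (Fin n)) =>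
      Complex.exp (-(t : ℂ) * ‖x‖ ^ 2 + (2 * π * Complex.I) * ((inner ℝ y x : ℝ) : ℂ)))
    (F' := fun (t : ℝ) (x : EuclideanSpace ℝ (Fin n)) => -(‖x‖ : ℂ) ^ 2 *
      Complex.exp (-(t : ℂ) * ‖x‖ ^ 2 + (2 * π * Complex.I) * ((inner ℝ y x : ℝ) : ℂ)))
    (x₀ := b) (s := Metric.ball b (b / 2))
    (bound := fun x => (4 / b) * Real.exp (-(b / 4) * ‖x‖ ^ 2))
    (Metric.ball_mem_nhds b (by positivity))
    (Filter.Eventually.of_forall fun t => by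
      apply Continuous.aestronglyMeasurable; fun_prop)
    (GaussianFourier.integrable_cexp_neg_mul_sq_norm_add (V := EuclideanSpace ℝ (Fin n))
      (b := (b : ℂ)) (by simpa using hb) (2 * π * Complex.I) y)
    (by apply Continuous.aestronglyMeasurable; fun_prop)
    (by
      refine Filter.Eventually.of_forall fun x t ht => ?_
      rw [Metric.mem_ball, Real.dist_eq, abs_lt] at ht
      rw [norm_mul, Complex.norm_exp]
      have h1 : (-(t : ℂ) * ‖x‖ ^ 2 + (2 * π * Complex.I) * ((inner ℝ y x : ℝ) : ℂ)).re
          = -t * ‖x‖ ^ 2 := by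
        have : (-(t : ℂ) * ‖x‖ ^ 2 + (2 * π * Complex.I) * ((inner ℝ y x : ℝ) : ℂ))
          = ((-t * ‖x‖ ^ 2 : ℝ) : ℂ) + ((2 * π * inner ℝ y x : ℝ) : ℂ) * Complex.I := by
          push_cast; ring
        rw [this, Complex.add_re, Complex.ofReal_re, Complex.re_ofReal_mul]
        simp
      rw [h1]
      have h2 : ‖-(‖x‖ : ℂ) ^ 2‖ = ‖x‖ ^ 2 := by simp
      rw [h2]
      have h3 : ‖x‖ ^ 2 ≤ 4 / b * Real.exp (b / 4 * ‖x‖ ^ 2) := by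
        have := Real.add_one_le_exp (b / 4 * ‖x‖ ^ 2)
        calc ‖x‖ ^ 2 = 4 / b * (b / 4 * ‖x‖ ^ 2) := by field_simp
          _ ≤ _ := by gcongr; linarith
      calc ‖x‖ ^ 2 * Real.exp (-t * ‖x‖ ^ 2)
          ≤ (4 / b * Real.exp (b / 4 * ‖x‖ ^ 2)) * Real.exp (-(b / 2) * ‖x‖ ^ 2) := by
            gcongr; linarith
        _ = _ := by
            rw [mul_assoc, ← Real.exp_add]; congr 2; ring)
    (by
      apply Integrable.const_mul
      have h := (GaussianFourier.integrable_cexp_neg_mul_sq_norm_add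
        (V := EuclideanSpace ℝ (Fin n))
        (b := ((b / 4 : ℝ) : ℂ)) (by rw [Complex.ofReal_re]; positivity) 0 0).norm
      refine h.congr (Filter.Eventually.of_forall fun x => ?_)
      simp only [Complex.norm_exp]
      congr 1
      rw [zero_mul, add_zero, ← Complex.ofReal_neg, ← Complex.ofReal_pow, ← Complex.ofReal_mul,
        Complex.ofReal_re])
    (by
      refine Filter.Eventually.of_forall fun x t _ => ?_
      have h : HasDerivAt (fun t : ℝ => -(t : ℂ) * (‖x‖ : ℂ) ^ 2
          + (2 * π * Complex.I) * ((inner ℝ y x : ℝ) : ℂ)) (-1 * (‖x‖ : ℂ) ^ 2) t :=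
        (((hasDerivAt_id t).ofReal_comp.neg).mul_const _).add_const _
      refine h.cexp.congr_deriv ?_
      simp only [neg_mul, one_mul, mul_neg]
      rw [mul_comm])
  refine ⟨key.1, ?_⟩
  have hd : HasDerivAt (fun t : ℝ => (π / t) ^ ((n : ℝ) / 2) * Real.exp (-π ^ 2 * ‖y‖ ^ 2 / t))
      ((π ^ 2 * ‖y‖ ^ 2 / b ^ 2 - n / (2 * b)) *
        ((π / b) ^ ((n : ℝ) / 2) * Real.exp (-π ^ 2 * ‖y‖ ^ 2 / b))) b := by
    have hpos : 0 < π / b := by positivity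
    have e1 := ((hasDerivAt_inv hb.ne').const_mul π)
    have e2 := e1.rpow_const (p := (n : ℝ) / 2) (Or.inl (by positivity))
    have e3 := ((hasDerivAt_inv hb.ne').const_mul (-π ^ 2 * ‖y‖ ^ 2)).exp
    have e4 := e2.mul e3
    simp only [← div_eq_mul_inv] at e4
    refine e4.congr_deriv ?_
    rw [Real.rpow_sub_one hpos.ne']
    field_simp
    ring
  have hd2 := hd.ofReal_comp
  refine key.2.unique (hd2.congr_of_eventuallyEq ?_)
  filter_upwards [lt_mem_nhds hb] with t ht
  exact aux_integral n t ht y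

/-- For `0 < c < 2π/n` and `a = 1/c² - n/(2πc)`, the function
`f(x) = (|x|² + a) e^{-πc|x|²}` is everywhere positive, and its Fourier transform
`f̂(y) = ∫ f(x) e^{2πi⟨x,y⟩} dx` is real and nonpositive for all `|y| ≥ 1`. -/
theorem gaussian_quadratic_pos_and_fourier_nonpos (n : ℕ) (hn : 0 < n) (c : ℝ)
    (hc : 0 < c) (hc' : c < 2 * π / n) (a : ℝ) (ha : a = 1 / c ^ 2 - n / (2 * π * c)) :
    (∀ x : EuclideanSpace ℝ (Fin n), 0 < (‖x‖ ^ 2 + a) * Real.exp (-π * c * ‖x‖ ^ 2)) ∧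
      ∀ y : EuclideanSpace ℝ (Fin n), 1 ≤ ‖y‖ →
        (∫ x : EuclideanSpace ℝ (Fin n),
            (((‖x‖ ^ 2 + a) * Real.exp (-π * c * ‖x‖ ^ 2) : ℝ) : ℂ) *
              Complex.exp (2 * π * Complex.I * ((inner ℝ x y : ℝ) : ℂ))).re ≤ 0 ∧
        (∫ x : EuclideanSpace ℝ (Fin n),
            (((‖x‖ ^ 2 + a) * Real.exp (-π * c * ‖x‖ ^ 2) : ℝ) : ℂ) *
              Complex.exp (2 * π * Complex.I * ((inner ℝ x y : ℝ) : ℂ))).im = 0 := by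
  have hn' : (0 : ℝ) < n := by exact_mod_cast hn
  have hpi := Real.pi_pos
  have ha0 : 0 < a := by
    have h : c * n < 2 * π := (lt_div_iff₀ hn').1 hc'
    have : a = (2 * π - c * n) / (2 * π * c ^ 2) := by rw [ha]; field_simp
    rw [this]
    apply div_pos (by linarith) (by positivity)
  refine ⟨fun x => by positivity, fun y hy => ?_⟩
  have hb : 0 < π * c := by positivity
  obtain ⟨hi, he⟩ := aux_main n (π * c) hb y
  have hI := GaussianFourier.integrable_cexp_neg_mul_sq_norm_add
    (V := EuclideanSpace ℝ (Fin n))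
    (b := ((π * c : ℝ) : ℂ)) (by simpa using hb) (2 * π * Complex.I) y
  have hE := aux_integral n (π * c) hb y
  have main : (∫ x : EuclideanSpace ℝ (Fin n),
      (((‖x‖ ^ 2 + a) * Real.exp (-π * c * ‖x‖ ^ 2) : ℝ) : ℂ) *
        Complex.exp (2 * π * Complex.I * ((inner ℝ x y : ℝ) : ℂ)))
      = (((1 - ‖y‖ ^ 2) / c ^ 2 *
        ((π / (π * c)) ^ ((n : ℝ) / 2) * Real.exp (-π ^ 2 * ‖y‖ ^ 2 / (π * c))) : ℝ) : ℂ) := by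
    have e : ∀ x : EuclideanSpace ℝ (Fin n),
        (((‖x‖ ^ 2 + a) * Real.exp (-π * c * ‖x‖ ^ 2) : ℝ) : ℂ) *
        Complex.exp (2 * π * Complex.I * ((inner ℝ x y : ℝ) : ℂ)) =
        (a : ℂ) * Complex.exp (-((π * c : ℝ) : ℂ) * ‖x‖ ^ 2
          + (2 * π * Complex.I) * ((inner ℝ y x : ℝ) : ℂ)) -
        -(‖x‖ : ℂ) ^ 2 * Complex.exp (-((π * c : ℝ) : ℂ) * ‖x‖ ^ 2
          + (2 * π * Complex.I) * ((inner ℝ y x : ℝ) : ℂ)) := by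
      intro x
      rw [real_inner_comm, Complex.exp_add]
      push_cast
      rw [neg_mul (π : ℂ) (c : ℂ)]
      ring
    simp_rw [e]
    rw [MeasureTheory.integral_sub (hI.const_mul _) hi, he, MeasureTheory.integral_const_mul, hE,
      ← Complex.ofReal_mul, ← Complex.ofReal_sub, ← sub_mul]
    congr 2
    rw [ha]
    field_simp
    ring
  rw [main, Complex.ofReal_re, Complex.ofReal_im]
  refine ⟨?_, rfl⟩
  apply mul_nonpos_of_nonpos_of_nonneg _ (by positivity)
  apply div_nonpos_of_nonpos_of_nonneg _ (by positivity)
  nlinarith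
end
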